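/- Let m be a positive integer and let L0 and L1 be real symmetric 5m×5m matrices such that for every t ∈ ℝ the matrix L(t) := cos(t)·L0 + sin(t)·L1 has eigenvalues exactly −√3, −1/√3, 0, 1/√3, √3, each with multiplicity m. Then L(t)·E is orthogonal to E for every t ∈ ℝ; that is, for all x, y ∈ E and all t ∈ ℝ one has ⟨L(t)·x, y⟩ = 0. In particular L0·E ⊥ E and L1·E ⊥ E. -/

import Mathlib

open Matrix

noncomputable section

/-- The family `L(t) = cos(t)·L0 + sin(t)·L1`. -/
def Lfam {n : ℕ} (L0 L1 : Matrix (Fin n) (Fin n) ℝ) (t : ℝ) : Matrix (Fin n) (Fin n) ℝ :=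
  Real.cos t • L0 + Real.sin t • L1

/-- `E`: the real subspace of `ℝ^{5m}` spanned by the kernels `ker L(t)`, `t ∈ ℝ`. -/
def Espan {n : ℕ} (L0 L1 : Matrix (Fin n) (Fin n) ℝ) : Submodule ℝ (Fin n → ℝ) :=
  ⨆ t : ℝ, LinearMap.ker (Lfam L0 L1 t).mulVecLin

theorem Matrix.IsSymm.eq_zero_of_pow_eq_zero {n : ℕ} {A : Matrix (Fin n) (Fin n) ℝ}
    (hA : A.IsSymm) {k : ℕ} (hk : A ^ k = 0) : A = 0 := by
  have key : ∀ j : ℕ, A ^ (2 ^ j) = 0 → A = 0 := by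
    intro j
    induction j with
    | zero => simp
    | succ j ih =>
      intro h
      refine ih (Matrix.conjTranspose_mul_self_eq_zero.1 ?_)
      rw [Matrix.conjTranspose_eq_transpose_of_trivial, (hA.pow _).eq, ← pow_add, ← h]
      congr 1
      ring
  exact key k (pow_eq_zero_of_le Nat.lt_two_pow_self.le hk)

section Family

open Polynomial Topology

variable {n : ℕ} {L0 L1 : Matrix (Fin n) (Fin n) ℝ}

theorem Lfam_isSymm (h0 : L0.IsSymm) (h1 : L1.IsSymm) (t : ℝ) : (Lfam L0 L1 t).IsSymm :=
  (h0.smul _).add (h1.smul _)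

theorem continuous_Lfam : Continuous (Lfam L0 L1) := by
  unfold Lfam
  fun_prop

theorem mul_eq_zero_of_charpoly {m : ℕ} {A : Matrix (Fin n) (Fin n) ℝ} (hA : A.IsSymm)
    (h : A.charpoly = (X ^ 2 - C 3) ^ m * (X ^ 2 - C (1 / 3 : ℝ)) ^ m * X ^ m) :
    A * ((A ^ 2 - 3) * (A ^ 2 - (1 / 3 : ℝ) • 1)) = 0 := by
  have hB : ((A ^ 2 - 3) * (A ^ 2 - (1 / 3 : ℝ) • 1) * A) ^ m = 0 := by
    have hc := A.aeval_self_charpoly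
    rw [h, ← mul_pow, ← mul_pow] at hc
    simpa [Algebra.algebraMap_eq_smul_one, map_ofNat] using hc
  have hA3 : Commute A (A ^ 2 - 3) :=
    ((Commute.refl A).pow_right 2).sub_right (Commute.ofNat_right A 3)
  have hA1 : Commute A (A ^ 2 - (1 / 3 : ℝ) • 1) :=
    ((Commute.refl A).pow_right 2).sub_right ((Commute.one_right A).smul_right _)
  have h31 : Commute (A ^ 2 - 3) (A ^ 2 - (1 / 3 : ℝ) • 1) :=
    (hA3.symm.pow_right 2).sub_right ((Commute.one_right _).smul_right _)
  have hS3 : (A ^ 2 - 3).IsSymm := (hA.pow 2).sub (Matrix.transpose_ofNat 3)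
  have hS1 : (A ^ 2 - (1 / 3 : ℝ) • 1).IsSymm := (hA.pow 2).sub (Matrix.isSymm_one.smul _)
  have hAB := hA3.mul_right hA1
  have hS : ((A ^ 2 - 3) * (A ^ 2 - (1 / 3 : ℝ) • 1) * A).IsSymm := by
    rw [Matrix.IsSymm, transpose_mul, transpose_mul, hA.eq, hS3.eq, hS1.eq, h31.symm.eq, hAB.eq]
  rw [hAB.eq]
  exact hS.eq_zero_of_pow_eq_zero hB

/-- Two kernel vectors at parameters `u`, `s` that differ modulo `π` are orthogonal with respect
to every form `L(t)`, since `L(t)` is a combination of `L(u)` and `L(s)`. -/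
theorem Lfam_mulVec_dotProduct_eq_zero_of_sin_ne_zero (h0 : L0.IsSymm) (h1 : L1.IsSymm)
    {s u : ℝ} (t : ℝ) (hsu : Real.sin (u - s) ≠ 0) {x y : Fin n → ℝ}
    (hx : Lfam L0 L1 u *ᵥ x = 0) (hy : Lfam L0 L1 s *ᵥ y = 0) :
    Lfam L0 L1 t *ᵥ x ⬝ᵥ y = 0 := by
  have hcomb : Real.sin (u - s) • Lfam L0 L1 t =
      Real.sin (u - t) • Lfam L0 L1 s + Real.sin (t - s) • Lfam L0 L1 u := by
    ext i j
    simp only [Lfam, Matrix.smul_apply, Matrix.add_apply, smul_eq_mul, Real.sin_sub]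
    ring
  have hs : Lfam L0 L1 s *ᵥ x ⬝ᵥ y = 0 := by
    rw [dotProduct_comm, dotProduct_mulVec, ← mulVec_transpose, (Lfam_isSymm h0 h1 s).eq, hy,
      zero_dotProduct]
  have h := congrArg (fun M : Matrix (Fin n) (Fin n) ℝ => M *ᵥ x ⬝ᵥ y) hcomb
  simp only [add_mulVec, smul_mulVec, hx, smul_zero, add_zero, smul_dotProduct, hs,
    smul_eq_mul, mul_zero] at h
  exact (mul_eq_zero.1 h).resolve_left hsu

theorem Lfam_mulVec_dotProduct_eq_zero {m : ℕ} (h0 : L0.IsSymm) (h1 : L1.IsSymm)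
    (hiso : ∀ t : ℝ, (Lfam L0 L1 t).charpoly =
      (X ^ 2 - C 3) ^ m * (X ^ 2 - C (1 / 3 : ℝ)) ^ m * X ^ m)
    {s u : ℝ} (t : ℝ) {x y : Fin n → ℝ}
    (hx : Lfam L0 L1 u *ᵥ x = 0) (hy : Lfam L0 L1 s *ᵥ y = 0) :
    Lfam L0 L1 t *ᵥ x ⬝ᵥ y = 0 := by
  set P : ℝ → Matrix (Fin n) (Fin n) ℝ := fun r =>
    (Lfam L0 L1 r ^ 2 - 3) * (Lfam L0 L1 r ^ 2 - (1 / 3 : ℝ) • 1) with hP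
  have hPx : P u *ᵥ x = x := by
    have h3 : (3 : Matrix (Fin n) (Fin n) ℝ) = (3 : ℝ) • 1 := by
      rw [← Algebra.algebraMap_eq_smul_one, map_ofNat]
    simp only [hP, h3, pow_two, ← mulVec_mulVec, sub_mulVec, hx, mulVec_zero, smul_mulVec,
      one_mulVec, zero_sub, mulVec_neg, mulVec_smul]
    norm_num [smul_smul]
  have hcont : Continuous fun r => Lfam L0 L1 t *ᵥ (P r *ᵥ x) ⬝ᵥ y := by
    have hL := continuous_Lfam (L0 := L0) (L1 := L1)
    fun_prop
  have hker : ∀ r, Lfam L0 L1 r *ᵥ (P r *ᵥ x) = 0 := fun r => by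
    rw [mulVec_mulVec, mul_eq_zero_of_charpoly (Lfam_isSymm h0 h1 r) (hiso r), zero_mulVec]
  by_cases hsu : Real.sin (u - s) = 0
  · have hne : ∀ᶠ r in 𝓝[>] u, Lfam L0 L1 t *ᵥ (P r *ᵥ x) ⬝ᵥ y = 0 := by
      filter_upwards [Ioo_mem_nhdsGT (lt_add_of_pos_right u Real.pi_pos)] with r hr
      refine Lfam_mulVec_dotProduct_eq_zero_of_sin_ne_zero h0 h1 t ?_ (hker r) hy
      have hpos : 0 < Real.sin (r - u) :=
        Real.sin_pos_of_pos_of_lt_pi (by linarith [hr.1]) (by linarith [hr.2])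
      have hcos : Real.cos (u - s) ≠ 0 := fun hc => by
        simpa [hsu, hc] using Real.sin_sq_add_cos_sq (u - s)
      rw [show r - s = (r - u) + (u - s) by ring, Real.sin_add, hsu, mul_zero, add_zero]
      exact mul_ne_zero hpos.ne' hcos
    have hlim := (hcont.tendsto u).mono_left (nhdsWithin_le_nhds (s := Set.Ioi u))
    have h := tendsto_nhds_unique (hlim.congr' hne) tendsto_const_nhds
    rwa [hPx] at h
  · exact Lfam_mulVec_dotProduct_eq_zero_of_sin_ne_zero h0 h1 t hsu hx hy

end Family

/-- for an isospectral family `L(t) = cos(t)·L0 + sin(t)·L1` of real symmetric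
`5m × 5m` matrices with spectrum `{-√3, -1/√3, 0, 1/√3, √3}` (each eigenvalue of
multiplicity `m`), the space `L(t)·E` is orthogonal to `E` for every `t`; in particular
`L0·E ⊥ E` and `L1·E ⊥ E`. -/
theorem statement4 (m : ℕ) (hm : 0 < m)
    (L0 L1 : Matrix (Fin (5 * m)) (Fin (5 * m)) ℝ)
    (h0 : L0.IsSymm) (h1 : L1.IsSymm)
    (hiso : ∀ t : ℝ, (Lfam L0 L1 t).charpoly =
      (Polynomial.X ^ 2 - Polynomial.C 3) ^ m *
        (Polynomial.X ^ 2 - Polynomial.C (1 / 3 : ℝ)) ^ m * Polynomial.X ^ m) :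
    (∀ t : ℝ, ∀ x ∈ Espan L0 L1, ∀ y ∈ Espan L0 L1, (Lfam L0 L1 t).mulVec x ⬝ᵥ y = 0) ∧
    (∀ x ∈ Espan L0 L1, ∀ y ∈ Espan L0 L1, L0.mulVec x ⬝ᵥ y = 0) ∧
    (∀ x ∈ Espan L0 L1, ∀ y ∈ Espan L0 L1, L1.mulVec x ⬝ᵥ y = 0) := by
  have main : ∀ t : ℝ, ∀ x ∈ Espan L0 L1, ∀ y ∈ Espan L0 L1,
      (Lfam L0 L1 t).mulVec x ⬝ᵥ y = 0 := by
    intro t x hx y hy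
    induction hx using Submodule.iSup_induction' with
    | zero => simp
    | add a b _ _ ha hb => rw [mulVec_add, add_dotProduct, ha, hb, add_zero]
    | mem u x hx =>
      induction hy using Submodule.iSup_induction' with
      | zero => simp
      | add a b _ _ ha hb => rw [dotProduct_add, ha, hb, add_zero]
      | mem s y hy => exact Lfam_mulVec_dotProduct_eq_zero h0 h1 hiso t hx hy
  refine ⟨main, ?_, ?_⟩
  · simpa [Lfam] using main 0
  · simpa [Lfam] using main (Real.pi / 2)

end
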